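/- Let T be an infinite, locally finite rooted tree with root o and no leaves except possibly o, with constant interaction strength J_v ≡ J > 0, inverse temperature β > 0 and θ = tanh(β J). Assign resistance θ^{-n} to every edge joining a vertex at distance n − 1 from o to a vertex at distance n. Then lim_N P^(N,+)(η(o) = +1) > 1/2 (phase transition with plus boundary conditions) if and only if cap_3(T) > 0. Moreover, if T is spherically symmetric with |T_n| vertices at distance n from o, this is equivalent to Σ_{n ≥ 1} θ^{-2n} |T_n|^{-2} < ∞. -/

import Mathlib

open scoped ENNReal Classical

noncomputable section

/-- Vertices of the canonical rooted tree: finite sequences of naturals; the root is `[]`. -/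
abbrev Vtx := List ℕ

/-- Vertices of the tree determined by the child-count function `c`. -/
inductive IsVtx (c : Vtx → ℕ) : Vtx → Prop
  | root : IsVtx c []
  | child {v : Vtx} {i : ℕ} : IsVtx c v → i < c v → IsVtx c (v ++ [i])

/-- A flow: conservation at every non-root, non-leaf vertex (edges are identified with their
lower endpoints). -/
def IsFlow (c : Vtx → ℕ) (μ : Vtx → ℝ≥0∞) : Prop :=
  ∀ v : Vtx, IsVtx c v → v ≠ [] → c v ≠ 0 →
    μ v = ∑ i ∈ Finset.range (c v), μ (v ++ [i])

/-- Total flow out of the root. -/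
def flowMass (c : Vtx → ℕ) (μ : Vtx → ℝ≥0∞) : ℝ≥0∞ :=
  ∑ i ∈ Finset.range (c []), μ [i]

/-- An infinite ray from the root. -/
def IsRay (c : Vtx → ℕ) (y : ℕ → ℕ) : Prop :=
  ∀ n : ℕ, y n < c ((List.range n).map y)

/-- `V_μ(y) = Σ_{e ∈ y} (μ(e) R(e))^s` along an infinite ray. -/
def rayPot (μ R : Vtx → ℝ≥0∞) (s : ℝ) (y : ℕ → ℕ) : ℝ≥0∞ :=
  ∑' n : ℕ, (μ ((List.range (n + 1)).map y) * R ((List.range (n + 1)).map y)) ^ s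

/-- `V_μ` along the maximal path from the root to a leaf `ℓ`. -/
def leafPot (μ R : Vtx → ℝ≥0∞) (s : ℝ) (ℓ : Vtx) : ℝ≥0∞ :=
  ∑ k ∈ Finset.range ℓ.length, (μ (ℓ.take (k + 1)) * R (ℓ.take (k + 1))) ^ s

/-- `cap_p` of an infinite leafless tree. -/
def capInf (c : Vtx → ℕ) (R : Vtx → ℝ≥0∞) (p : ℝ) : ℝ≥0∞ :=
  sSup {m | ∃ μ : Vtx → ℝ≥0∞, IsFlow c μ ∧
    (∀ y : ℕ → ℕ, IsRay c y → rayPot μ R (p - 1) y ≤ 1) ∧ m = flowMass c μ}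

/-- `cap_p` of a finite tree. -/
def capFin (c : Vtx → ℕ) (R : Vtx → ℝ≥0∞) (p : ℝ) : ℝ≥0∞ :=
  sSup {m | ∃ μ : Vtx → ℝ≥0∞, IsFlow c μ ∧
    (∀ ℓ : Vtx, IsVtx c ℓ → c ℓ = 0 → leafPot μ R (p - 1) ℓ ≤ 1) ∧ m = flowMass c μ}

/-- The set of vertices at distance `n` from the root. -/
def lev (c : Vtx → ℕ) : ℕ → Finset Vtx
  | 0 => {([] : Vtx)}
  | n + 1 => (lev c n).biUnion fun v => (Finset.range (c v)).image fun i => v ++ [i]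

/-- The vertices of the truncated tree `T^(N)`. -/
def verts (c : Vtx → ℕ) (N : ℕ) : Finset Vtx := (Finset.range (N + 1)).biUnion (lev c)

/-- Spin configurations on `T^(N)`. -/
def Conf (c : Vtx → ℕ) (N : ℕ) := {v // v ∈ verts c N} → Bool

instance (c : Vtx → ℕ) (N : ℕ) : Fintype (Conf c N) := by unfold Conf; infer_instance

/-- The ±1 spin of a configuration at a vertex. -/
def spin (c : Vtx → ℕ) (N : ℕ) (σ : Conf c N) (w : Vtx) : ℝ :=
  if h : w ∈ verts c N then (if σ ⟨w, h⟩ then 1 else -1) else 1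

/-- The weight `W(η) = Π_{v → w} exp(β J_w η(v) η(w))` of a configuration on `T^(N)`. -/
def wt (c : Vtx → ℕ) (J : Vtx → ℝ) (β : ℝ) (N : ℕ) (σ : Conf c N) : ℝ :=
  ∏ w ∈ (Finset.range N).biUnion (fun n => lev c (n + 1)),
    Real.exp (β * J w * spin c N σ w.dropLast * spin c N σ w)

/-- `P^(N,+)(η(o) = +1)`: probability of a plus spin at the root under plus boundary
conditions at level `N`. -/
def plusProb (c : Vtx → ℕ) (J : Vtx → ℝ) (β : ℝ) (N : ℕ) : ℝ :=
  (∑ σ : Conf c N, if (∀ x : {v // v ∈ verts c N}, x.1 ∈ lev c N → σ x = true)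
      ∧ spin c N σ [] = 1 then wt c J β N σ else 0) /
  (∑ σ : Conf c N, if (∀ x : {v // v ∈ verts c N}, x.1 ∈ lev c N → σ x = true)
      then wt c J β N σ else 0)


/-- The log-likelihood ratio sent through an edge of inverse temperature `b` by a vertex whose own
log-likelihood ratio is `x`. -/
def isingMap (b x : ℝ) : ℝ :=
  Real.log ((Real.exp b * Real.exp x + Real.exp (-b)) / (Real.exp (-b) * Real.exp x + Real.exp b))

/-- The series law for the normalised `3`-capacity. -/
def capMap (θ x : ℝ) : ℝ := θ * x / √(1 + x ^ 2)

lemma hasDerivAt_isingMap (b x : ℝ) :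
    HasDerivAt (isingMap b) (Real.tanh b / (1 + (Real.cosh x - 1) / (2 * Real.cosh b ^ 2))) x := by
  have h1 : 0 < Real.exp b * Real.exp x + Real.exp (-b) := by positivity
  have h2 : 0 < Real.exp (-b) * Real.exp x + Real.exp b := by positivity
  have d1 : HasDerivAt (fun x => Real.exp b * Real.exp x + Real.exp (-b))
      (Real.exp b * Real.exp x) x := ((Real.hasDerivAt_exp x).const_mul _).add_const _
  have d2 : HasDerivAt (fun x => Real.exp (-b) * Real.exp x + Real.exp b)
      (Real.exp (-b) * Real.exp x) x := ((Real.hasDerivAt_exp x).const_mul _).add_const _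
  have hf : isingMap b = fun x => Real.log (Real.exp b * Real.exp x + Real.exp (-b)) -
      Real.log (Real.exp (-b) * Real.exp x + Real.exp b) := by
    funext y
    rw [isingMap, Real.log_div (by positivity) (by positivity)]
  rw [hf]
  refine ((d1.log h1.ne').sub (d2.log h2.ne')).congr_deriv (Eq.symm ?_)
  rw [Real.tanh_eq_sinh_div_cosh, Real.sinh_eq, Real.cosh_eq, Real.cosh_eq]
  simp only [Real.exp_neg] at *
  have e1 := Real.exp_pos b
  have e2 := Real.exp_pos x
  generalize Real.exp b = u at *
  generalize Real.exp x = w at *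
  have h3 : 1 + ((w + w⁻¹) / 2 - 1) / (2 * ((u + u⁻¹) / 2) ^ 2) =
      (u * w + u⁻¹) * (u⁻¹ * w + u) / (w * (u + u⁻¹) ^ 2) := by
    field_simp
    ring
  rw [h3]
  field_simp
  ring

lemma isingMap_zero (b : ℝ) : isingMap b 0 = 0 := by
  rw [isingMap, Real.exp_zero, mul_one, mul_one, add_comm, div_self (by positivity), Real.log_one]

lemma tanh_pos_of_pos {b : ℝ} (hb : 0 < b) : 0 < Real.tanh b := by
  rw [Real.tanh_eq_sinh_div_cosh]
  exact div_pos (Real.sinh_pos_iff.2 hb) (Real.cosh_pos b)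

lemma isingMap_monotone {b : ℝ} (hb : 0 < b) : Monotone (isingMap b) := by
  refine monotone_of_deriv_nonneg (fun x => (hasDerivAt_isingMap b x).differentiableAt) fun x => ?_
  rw [(hasDerivAt_isingMap b x).deriv]
  have h1 := Real.one_le_cosh x
  have h2 := Real.cosh_pos b
  have h3 := tanh_pos_of_pos hb
  have : 0 ≤ Real.cosh x - 1 := by linarith
  positivity

lemma isingMap_nonneg {b x : ℝ} (hb : 0 < b) (hx : 0 ≤ x) : 0 ≤ isingMap b x :=
  isingMap_zero b ▸ isingMap_monotone hb hx

lemma isingMap_le {b : ℝ} (hb : 0 < b) (x : ℝ) : isingMap b x ≤ 2 * b := by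
  rw [isingMap, Real.log_le_iff_le_exp (by positivity), div_le_iff₀ (by positivity)]
  have h1 : Real.exp (2 * b) * Real.exp (-b) = Real.exp b := by rw [← Real.exp_add]; ring_nf
  have h2 : Real.exp (-b) ≤ Real.exp (2 * b) * Real.exp b := by
    rw [← Real.exp_add]; exact Real.exp_le_exp.2 (by linarith)
  rw [mul_add, ← mul_assoc, h1]
  linarith

lemma capMap_nonneg {θ x : ℝ} (hθ : 0 ≤ θ) (hx : 0 ≤ x) : 0 ≤ capMap θ x := by
  unfold capMap; positivity

lemma hasDerivAt_div_sqrt (θ k x : ℝ) (hk : 0 ≤ k) :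
    HasDerivAt (fun x => θ * x / √(1 + k * x ^ 2)) (θ / (√(1 + k * x ^ 2)) ^ 3) x := by
  have h0 : 0 < 1 + k * x ^ 2 := by positivity
  have h1 : HasDerivAt (fun x : ℝ => 1 + k * x ^ 2) (k * (2 * x)) x := by
    simpa using (((hasDerivAt_id x).pow 2).const_mul k).const_add 1
  have h2 := h1.sqrt h0.ne'
  have h3 : HasDerivAt (fun x : ℝ => θ * x) θ x := by simpa using (hasDerivAt_id x).const_mul θ
  have hs : 0 < √(1 + k * x ^ 2) := Real.sqrt_pos.2 h0
  refine (h3.div h2 hs.ne').congr_deriv (Eq.symm ?_)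
  have hq : √(1 + k * x ^ 2) ^ 2 = 1 + k * x ^ 2 := Real.sq_sqrt h0.le
  field_simp
  rw [hq]
  ring

lemma capMap_monotone {θ : ℝ} (hθ : 0 ≤ θ) : Monotone (capMap θ) := by
  have h : ∀ x, HasDerivAt (capMap θ) (θ / (√(1 + 1 * x ^ 2)) ^ 3) x := by
    have : capMap θ = fun x => θ * x / √(1 + 1 * x ^ 2) := by funext x; simp [capMap]
    rw [this]
    exact fun x => hasDerivAt_div_sqrt θ 1 x zero_le_one
  refine monotone_of_deriv_nonneg (fun x => (h x).differentiableAt) fun x => ?_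
  rw [(h x).deriv]
  positivity

lemma capMap_continuous (θ : ℝ) : Continuous (capMap θ) := by
  unfold capMap
  refine Continuous.div (by fun_prop) (by fun_prop) fun x => ?_
  have : 0 < 1 + x ^ 2 := by positivity
  exact (Real.sqrt_pos.2 this).ne'

lemma capMap_le {θ : ℝ} (hθ : 0 ≤ θ) (x : ℝ) : capMap θ x ≤ θ := by
  have h : 0 < 1 + x ^ 2 := by positivity
  rw [capMap, div_le_iff₀ (Real.sqrt_pos.2 h)]
  refine mul_le_mul_of_nonneg_left (Real.le_sqrt_of_sq_le ?_) hθ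
  linarith

lemma tanh_le_self {x : ℝ} (hx : 0 ≤ x) : Real.tanh x ≤ x := by
  have h : MonotoneOn (fun x => x * Real.cosh x - Real.sinh x) (Set.Ici 0) := by
    refine monotoneOn_of_deriv_nonneg (convex_Ici 0) (by fun_prop) (by fun_prop) fun y hy => ?_
    have hy' : 0 < y := by simpa using hy
    have hd : HasDerivAt (fun x => x * Real.cosh x - Real.sinh x)
        (1 * Real.cosh y + y * Real.sinh y - Real.cosh y) y :=
      ((hasDerivAt_id y).mul (Real.hasDerivAt_cosh y)).sub (Real.hasDerivAt_sinh y)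
    rw [hd.deriv]
    have := mul_pos hy' (Real.sinh_pos_iff.2 hy')
    linarith
  have h0 := h (Set.self_mem_Ici) (Set.mem_Ici.2 hx) hx
  simp only [zero_mul, Real.sinh_zero, sub_zero] at h0
  rw [Real.tanh_eq_sinh_div_cosh, div_le_iff₀ (Real.cosh_pos x)]
  linarith

lemma div_sqrt_le_tanh {x : ℝ} (hx : 0 ≤ x) : x / √(1 + x ^ 2) ≤ Real.tanh x := by
  have h1 : x ≤ Real.sinh x := Real.self_le_sinh_iff.2 hx
  have h2 := capMap_monotone zero_le_one h1
  have h3 : √(1 + Real.sinh x ^ 2) = Real.cosh x := by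
    rw [add_comm, ← Real.cosh_sq, Real.sqrt_sq (Real.cosh_pos x).le]
  rw [Real.tanh_eq_sinh_div_cosh]
  simpa [capMap, h3] using h2

lemma tanh_isingMap (b x : ℝ) :
    Real.tanh (isingMap b (2 * x) / 2) = Real.tanh b * Real.tanh x := by
  have key : ∀ y : ℝ, Real.tanh y = (Real.exp (2 * y) - 1) / (Real.exp (2 * y) + 1) := by
    intro y
    rw [Real.tanh_eq_sinh_div_cosh, Real.sinh_eq, Real.cosh_eq, two_mul, Real.exp_add, Real.exp_neg]
    have := Real.exp_pos y
    field_simp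
  rw [key, key b, key x, mul_div_cancel₀ _ (two_ne_zero), isingMap, Real.exp_log (by positivity),
    two_mul b, Real.exp_add, Real.exp_neg]
  have h1 := Real.exp_pos b
  have h2 := Real.exp_pos (2 * x)
  generalize Real.exp b = u at *
  generalize Real.exp (2 * x) = w at *
  field_simp
  ring_nf

lemma two_mul_capMap_le {b x : ℝ} (hb : 0 < b) (hx : 0 ≤ x) :
    2 * capMap (Real.tanh b) x ≤ isingMap b (2 * x) := by
  have h1 : 0 ≤ isingMap b (2 * x) := isingMap_nonneg hb (by positivity)
  have h2 := tanh_le_self (x := isingMap b (2 * x) / 2) (by positivity)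
  rw [tanh_isingMap] at h2
  have h3 := mul_le_mul_of_nonneg_left (div_sqrt_le_tanh hx) (tanh_pos_of_pos hb).le
  rw [capMap, mul_div_assoc]
  linarith

lemma cosh_eq_one_add (x : ℝ) : Real.cosh x = 1 + 2 * Real.sinh (x / 2) ^ 2 := by
  have := Real.cosh_two_mul (x / 2)
  rw [mul_div_cancel₀ _ (two_ne_zero)] at this
  rw [this, Real.cosh_sq]
  ring

lemma add_cube_le_sinh {x : ℝ} (hx : 0 ≤ x) : x + x ^ 3 / 6 ≤ Real.sinh x := by
  have h : MonotoneOn (fun x => Real.sinh x - (x + x ^ 3 / 6)) (Set.Ici 0) := by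
    refine monotoneOn_of_deriv_nonneg (convex_Ici 0) (by fun_prop) (by fun_prop) fun y hy => ?_
    have hy' : 0 < y := by simpa using hy
    have hd : HasDerivAt (fun x => Real.sinh x - (x + x ^ 3 / 6))
        (Real.cosh y - (1 + 3 * y ^ 2 / 6)) y := by
      have := ((hasDerivAt_id y).pow 3).div_const 6
      refine (Real.hasDerivAt_sinh y).sub ((hasDerivAt_id y).add ?_)
      simpa using this
    rw [hd.deriv, cosh_eq_one_add]
    have h1 : y / 2 ≤ Real.sinh (y / 2) := Real.self_le_sinh_iff.2 (by positivity)
    have h2 : (y / 2) ^ 2 ≤ Real.sinh (y / 2) ^ 2 := by gcongr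
    linarith
  have h0 := h (Set.self_mem_Ici) (Set.mem_Ici.2 hx) hx
  simp only [Real.sinh_zero] at h0
  linarith

lemma cosh_lower {x : ℝ} (hx : 0 ≤ x) : 1 + x ^ 2 / 2 + x ^ 4 / 24 ≤ Real.cosh x := by
  have h : 2 * (x / 2 + (x / 2) ^ 3 / 6) ^ 2 ≤ 2 * Real.sinh (x / 2) ^ 2 := by
    have := add_cube_le_sinh (x := x / 2) (by positivity)
    gcongr
  rw [cosh_eq_one_add]
  nlinarith [sq_nonneg (x ^ 3)]

lemma isingMap_le_div_sqrt {b k x : ℝ} (hb : 0 < b) (hk : 0 ≤ k)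
    (hkb : 8 * k * Real.cosh b ^ 2 ≤ 1) (hx : 0 ≤ x) :
    isingMap b x ≤ Real.tanh b * x / √(1 + k * x ^ 2) := by
  have hmono : MonotoneOn (fun x => Real.tanh b * x / √(1 + k * x ^ 2) - isingMap b x)
      (Set.Ici 0) := by
    have hd : ∀ y, HasDerivAt (fun x => Real.tanh b * x / √(1 + k * x ^ 2) - isingMap b x)
        (Real.tanh b / (√(1 + k * y ^ 2)) ^ 3 -
          Real.tanh b / (1 + (Real.cosh y - 1) / (2 * Real.cosh b ^ 2))) y := fun y =>
      (hasDerivAt_div_sqrt _ k y hk).sub (hasDerivAt_isingMap b y)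
    refine monotoneOn_of_deriv_nonneg (convex_Ici 0)
      (fun y _ => (hd y).continuousAt.continuousWithinAt)
      (fun y _ => (hd y).differentiableAt.differentiableWithinAt) fun y hy => ?_
    have hy' : 0 < y := by simpa using hy
    rw [(hd y).deriv, sub_nonneg]
    have h0 : 0 < 1 + k * y ^ 2 := by positivity
    refine div_le_div_of_nonneg_left (tanh_pos_of_pos hb).le
      (pow_pos (Real.sqrt_pos.2 h0) 3) ?_
    have hc := Real.one_le_cosh b
    set A : ℝ := 1 / (4 * Real.cosh b ^ 2) with hA
    have hA0 : 0 < A := by positivity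
    have hA1 : A ≤ 1 / 4 := by
      rw [hA]
      apply one_div_le_one_div_of_le <;> nlinarith
    have hkA : k ≤ A / 2 := by
      rw [hA, div_div, le_div_iff₀ (by positivity)]
      linarith
    have h1 : 1 + A * y ^ 2 + A * y ^ 4 / 12 ≤
        1 + (Real.cosh y - 1) / (2 * Real.cosh b ^ 2) := by
      have : (Real.cosh y - 1) / (2 * Real.cosh b ^ 2) = 2 * A * (Real.cosh y - 1) := by
        rw [hA]; field_simp; ring
      rw [this]
      have := mul_le_mul_of_nonneg_left (cosh_lower hy'.le) hA0.le
      linarith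
    refine le_trans ?_ h1
    refine le_of_sq_le_sq ?_ (by positivity)
    rw [← pow_mul, mul_comm 3 2, pow_mul, Real.sq_sqrt h0.le]
    have h2 : (1 + k * y ^ 2) ^ 3 ≤ (1 + A / 2 * y ^ 2) ^ 3 := by gcongr
    refine h2.trans ?_
    have h3 : 0 ≤ A * (1 / 4 - A) * y ^ 6 * A := by
      have : 0 ≤ 1 / 4 - A := by linarith
      positivity
    have h4 : 0 ≤ A * y ^ 2 := by positivity
    have h5 : 0 ≤ A ^ 2 * y ^ 4 := by positivity
    have h6 : 0 ≤ A * y ^ 4 := by positivity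
    have h7 : 0 ≤ A ^ 2 * y ^ 6 := by positivity
    have h8 : 0 ≤ A ^ 2 * y ^ 8 := by positivity
    nlinarith
  have h0 := hmono (Set.self_mem_Ici) (Set.mem_Ici.2 hx) hx
  simp only [isingMap_zero, mul_zero, zero_div, sub_zero] at h0
  linarith

lemma exists_mul_isingMap_le {b : ℝ} (hb : 0 < b) : ∃ κ : ℝ, 0 < κ ∧
    κ * (2 * b) ≤ Real.tanh b ∧
    ∀ x, 0 ≤ x → κ * isingMap b x ≤ capMap (Real.tanh b) (κ * x) := by
  have ht := tanh_pos_of_pos hb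
  have hc := Real.cosh_pos b
  refine ⟨min (1 / (3 * Real.cosh b)) (Real.tanh b / (2 * b)), by positivity, ?_, ?_⟩
  · exact (mul_le_mul_of_nonneg_right (min_le_right _ _) (by positivity)).trans
      (by rw [div_mul_cancel₀ _ (by positivity)])
  · intro x hx
    set κ := min (1 / (3 * Real.cosh b)) (Real.tanh b / (2 * b)) with hκ
    have hκ0 : 0 < κ := by positivity
    have h1 : κ * (3 * Real.cosh b) ≤ 1 := by
      rw [← le_div_iff₀ (by positivity)]; exact min_le_left _ _
    have h2 : 8 * κ ^ 2 * Real.cosh b ^ 2 ≤ 1 := by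
      have : (κ * (3 * Real.cosh b)) ^ 2 ≤ 1 := pow_le_one₀ (by positivity) h1
      nlinarith
    have h3 := mul_le_mul_of_nonneg_left
      (isingMap_le_div_sqrt hb (sq_nonneg κ) h2 hx) hκ0.le
    rw [capMap]
    refine h3.trans (le_of_eq ?_)
    rw [mul_pow]
    ring

/-- The message sent by `v` to its parent when the tree below `v` is cut at depth `k`: messages of
the children are summed and transformed by `g`, starting from the boundary message `t`. -/
def msg (c : Vtx → ℕ) (g : ℝ → ℝ) (t : ℝ) : ℕ → Vtx → ℝ
  | 0, _ => t
  | k + 1, v => g (∑ i ∈ Finset.range (c v), msg c g t k (v ++ [i]))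

/-- The sum of the messages received by `v` from its children. -/
def inflow (c : Vtx → ℕ) (g : ℝ → ℝ) (t : ℝ) (k : ℕ) (v : Vtx) : ℝ :=
  ∑ i ∈ Finset.range (c v), msg c g t k (v ++ [i])

section Messages

variable {c : Vtx → ℕ} {g : ℝ → ℝ} {t : ℝ}

lemma msg_succ (k : ℕ) (v : Vtx) : msg c g t (k + 1) v = g (inflow c g t k v) := rfl

lemma msg_nonneg (ht : 0 ≤ t) (hg : ∀ x, 0 ≤ x → 0 ≤ g x) (k : ℕ) (v : Vtx) :
    0 ≤ msg c g t k v := by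
  induction k generalizing v with
  | zero => exact ht
  | succ k ih => exact hg _ (Finset.sum_nonneg fun i _ => ih _)

lemma inflow_nonneg (ht : 0 ≤ t) (hg : ∀ x, 0 ≤ x → 0 ≤ g x) (k : ℕ) (v : Vtx) :
    0 ≤ inflow c g t k v :=
  Finset.sum_nonneg fun _ _ => msg_nonneg ht hg k _

lemma msg_antitone (hg : Monotone g) (hgt : ∀ x, g x ≤ t) (v : Vtx) :
    Antitone fun k => msg c g t k v := by
  refine antitone_nat_of_succ_le fun k => ?_
  induction k generalizing v with
  | zero => exact hgt _
  | succ k ih => exact hg (Finset.sum_le_sum fun i _ => ih _)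

lemma inflow_antitone (hg : Monotone g) (hgt : ∀ x, g x ≤ t) (v : Vtx) :
    Antitone fun k => inflow c g t k v :=
  fun _ _ h => Finset.sum_le_sum fun _ _ => msg_antitone hg hgt _ h

lemma mul_msg_le {g' : ℝ → ℝ} {a t' : ℝ} (ht : 0 ≤ t) (hg : ∀ x, 0 ≤ x → 0 ≤ g x)
    (hg' : Monotone g') (hat : a * t ≤ t') (h : ∀ x, 0 ≤ x → a * g x ≤ g' (a * x))
    (k : ℕ) (v : Vtx) : a * msg c g t k v ≤ msg c g' t' k v := by
  induction k generalizing v with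
  | zero => exact hat
  | succ k ih =>
    refine (h _ (inflow_nonneg ht hg k v)).trans (hg' ?_)
    rw [inflow, Finset.mul_sum]
    exact Finset.sum_le_sum fun i _ => ih _

lemma mul_inflow_le {g' : ℝ → ℝ} {a t' : ℝ} (ht : 0 ≤ t) (hg : ∀ x, 0 ≤ x → 0 ≤ g x)
    (hg' : Monotone g') (hat : a * t ≤ t') (h : ∀ x, 0 ≤ x → a * g x ≤ g' (a * x))
    (k : ℕ) (v : Vtx) : a * inflow c g t k v ≤ inflow c g' t' k v := by
  rw [inflow, Finset.mul_sum]
  exact Finset.sum_le_sum fun i _ => mul_msg_le ht hg hg' hat h k _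

end Messages

lemma exists_le_inflow_ising_iff (c : Vtx → ℕ) {b : ℝ} (hb : 0 < b) :
    (∃ ε > 0, ∀ k, ε ≤ inflow c (isingMap b) (2 * b) k []) ↔
      ∃ ε > 0, ∀ k, ε ≤ inflow c (capMap (Real.tanh b)) (Real.tanh b) k [] := by
  have hθ := tanh_pos_of_pos hb
  constructor
  · rintro ⟨ε, hε, h⟩
    obtain ⟨κ, hκ, hκt, hκg⟩ := exists_mul_isingMap_le hb
    refine ⟨κ * ε, by positivity, fun k => ?_⟩
    exact (mul_le_mul_of_nonneg_left (h k) hκ.le).trans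
      (mul_inflow_le (by positivity) (fun x => isingMap_nonneg hb) (capMap_monotone hθ.le)
        hκt hκg k [])
  · rintro ⟨ε, hε, h⟩
    refine ⟨2 * ε, by positivity, fun k => ?_⟩
    refine (mul_le_mul_of_nonneg_left (h k) zero_le_two).trans
      (mul_inflow_le hθ.le (fun x => capMap_nonneg hθ.le) (isingMap_monotone hb) ?_
        (fun x => two_mul_capMap_le hb) k [])
    linarith [tanh_le_self hb.le]

lemma mem_lev {c : Vtx → ℕ} {n : ℕ} {v : Vtx} : v ∈ lev c n ↔ IsVtx c v ∧ v.length = n := by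
  induction n generalizing v with
  | zero =>
    simp only [lev, Finset.mem_singleton, List.length_eq_zero_iff]
    exact ⟨fun h => ⟨h ▸ IsVtx.root, h⟩, fun h => h.2⟩
  | succ n ih =>
    simp only [lev, Finset.mem_biUnion, Finset.mem_image, Finset.mem_range]
    constructor
    · rintro ⟨u, hu, i, hi, rfl⟩
      have := ih.1 hu
      exact ⟨this.1.child hi, by simp [this.2]⟩
    · rintro ⟨hv, hl⟩
      cases hv with
      | root => simp at hl
      | child hu hi => exact ⟨_, ih.2 ⟨hu, by simpa using hl⟩, _, hi, rfl⟩

lemma IsVtx.getElem_lt {c : Vtx → ℕ} {v : Vtx} (hv : IsVtx c v) (n : ℕ) (hn : n < v.length) :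
    v[n] < c (v.take n) := by
  induction hv with
  | root => simp at hn
  | @child u i hu hi ih =>
    rcases Nat.lt_succ_iff_lt_or_eq.1 (by simpa using hn : n < u.length + 1) with h | h
    · rw [List.getElem_append_left h, List.take_append_of_le_length h.le]
      exact ih h
    · subst h
      simpa using hi

lemma map_range_succ (y : ℕ → ℕ) (n : ℕ) :
    (List.range (n + 1)).map y = (List.range n).map y ++ [y n] := by
  rw [List.range_succ, List.map_append, List.map_singleton]

lemma IsVtx.exists_isRay {c : Vtx → ℕ} (hc : ∀ v, IsVtx c v → 1 ≤ c v) {v : Vtx}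
    (hv : IsVtx c v) : ∃ y, IsRay c y ∧ (List.range v.length).map y = v := by
  have key : ∀ n ≤ v.length, (List.range n).map (fun n => v.getD n 0) = v.take n := by
    intro n hn
    refine List.ext_getElem (by simpa using hn) fun i h1 h2 => ?_
    have : i < n := by simpa using h1
    simp [show i < v.length by omega]
  have hlt : ∀ n, IsVtx c ((List.range n).map fun n => v.getD n 0) →
      v.getD n 0 < c ((List.range n).map fun n => v.getD n 0) := by
    intro n hn
    by_cases h : n < v.length
    · rw [key n h.le, List.getD_eq_getElem _ _ h]
      exact hv.getElem_lt n h
    · rw [List.getD_eq_default _ _ (not_lt.1 h)]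
      exact hc _ hn
  have hvtx : ∀ n, IsVtx c ((List.range n).map fun n => v.getD n 0) := by
    intro n
    induction n with
    | zero => exact IsVtx.root
    | succ n ih => rw [map_range_succ]; exact ih.child (hlt n ih)
  exact ⟨fun n => v.getD n 0, fun n => hlt n (hvtx n), by rw [key _ le_rfl, List.take_length]⟩

section Capacity

variable {c : Vtx → ℕ} {θ : ℝ}

lemma le_mul_div_sqrt {q B x : ℝ} (hq : 0 ≤ q) (hqB : q ^ 2 ≤ B ^ 2) (hB : 0 ≤ B)
    (h : q ≤ √(B ^ 2 - q ^ 2) * x) : q ≤ B * (x / √(1 + x ^ 2)) := by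
  have h1 : 0 < 1 + x ^ 2 := by positivity
  by_cases hx : 0 ≤ x
  · have h2 : q ^ 2 ≤ (B ^ 2 - q ^ 2) * x ^ 2 := by
      have := pow_le_pow_left₀ hq h 2
      rwa [mul_pow, Real.sq_sqrt (by linarith)] at this
    rw [← mul_div_assoc, le_div_iff₀ (Real.sqrt_pos.2 h1)]
    refine le_of_sq_le_sq ?_ (by positivity)
    rw [mul_pow, Real.sq_sqrt h1.le]
    linarith
  · have h2 : √(B ^ 2 - q ^ 2) * x ≤ 0 :=
      mul_nonpos_of_nonneg_of_nonpos (Real.sqrt_nonneg _) (not_le.1 hx).le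
    have h3 : q = 0 := le_antisymm (h.trans h2) hq
    subst h3
    have h4 : B * x ≥ 0 := by
      have : √(B ^ 2 - 0 ^ 2) = B := by simp [Real.sqrt_sq hB]
      rwa [this] at h
    rw [← mul_div_assoc]
    positivity

/-- A flow of bounded potential below `w` carries at most the finite-depth capacity below `w`. -/
lemma flow_le_msg (hc : ∀ v, IsVtx c v → 1 ≤ c v) (hθ : 0 < θ) {m : Vtx → ℝ}
    (hm : ∀ v, 0 ≤ m v)
    (hflow : ∀ v, IsVtx c v → v ≠ [] → m v = ∑ i ∈ Finset.range (c v), m (v ++ [i]))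
    (k : ℕ) {w : Vtx} (hw : IsVtx c w) (hw0 : w ≠ []) {B : ℝ} (hB : 0 ≤ B)
    (hpot : ∀ y, IsRay c y → (List.range w.length).map y = w →
      ∑ j ∈ Finset.range (k + 1),
        (m ((List.range (w.length + j)).map y) * (θ ^ (w.length + j))⁻¹) ^ 2 ≤ B ^ 2) :
    m w * (θ ^ w.length)⁻¹ ≤ B * (msg c (capMap θ) θ k w / θ) := by
  induction k generalizing w B with
  | zero =>
    obtain ⟨y, hy, hyw⟩ := hw.exists_isRay hc
    have h := hpot y hy hyw
    rw [zero_add, Finset.sum_range_one, add_zero, hyw] at h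
    rw [msg, div_self hθ.ne', mul_one]
    exact le_of_sq_le_sq h hB
  | succ k ih =>
    set q := m w * (θ ^ w.length)⁻¹ with hq
    have hq0 : 0 ≤ q := mul_nonneg (hm w) (by positivity)
    have htail : ∀ y, IsRay c y → (List.range w.length).map y = w →
        q ^ 2 + ∑ j ∈ Finset.range (k + 1),
          (m ((List.range (w.length + 1 + j)).map y) * (θ ^ (w.length + 1 + j))⁻¹) ^ 2
            ≤ B ^ 2 := by
      intro y hy hyw
      have h := hpot y hy hyw
      rw [Finset.sum_range_succ', add_zero, hyw, add_comm] at h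
      simpa only [add_assoc, add_comm 1] using h
    have hqB : q ^ 2 ≤ B ^ 2 := by
      obtain ⟨y, hy, hyw⟩ := hw.exists_isRay hc
      exact le_trans (le_add_of_nonneg_right (Finset.sum_nonneg fun _ _ => sq_nonneg _))
        (htail y hy hyw)
    have hchild : ∀ i ∈ Finset.range (c w),
        m (w ++ [i]) * (θ ^ (w.length + 1))⁻¹ ≤
          √(B ^ 2 - q ^ 2) * (msg c (capMap θ) θ k (w ++ [i]) / θ) := by
      intro i hi
      have := ih (hw.child (Finset.mem_range.1 hi)) (by simp) (Real.sqrt_nonneg (B ^ 2 - q ^ 2))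
        (fun y hy hyw => ?_)
      · simpa using this
      · rw [List.length_append, List.length_singleton] at hyw ⊢
        rw [map_range_succ] at hyw
        rw [Real.sq_sqrt (by linarith)]
        have := htail y hy (List.append_inj_left' hyw rfl)
        linarith
    have hsum := Finset.sum_le_sum hchild
    rw [← Finset.sum_mul, ← hflow w hw hw0, ← Finset.mul_sum, ← Finset.sum_div] at hsum
    have hq' : q ≤ √(B ^ 2 - q ^ 2) * inflow c (capMap θ) θ k w := by
      have := mul_le_mul_of_nonneg_right hsum hθ.le
      have e : m w * (θ ^ (w.length + 1))⁻¹ * θ = q := by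
        rw [hq, pow_succ]; field_simp
      rw [e, mul_assoc, div_mul_cancel₀ _ hθ.ne'] at this
      exact this
    have := le_mul_div_sqrt hq0 hqB hB hq'
    rw [msg_succ, capMap, mul_div_assoc, mul_div_cancel_left₀ _ hθ.ne']
    exact this

lemma exists_le_inflow_of_capInf_pos (hc : ∀ v, IsVtx c v → 1 ≤ c v) (hθ : 0 < θ)
    (h : 0 < capInf c (fun v => (ENNReal.ofReal θ ^ v.length)⁻¹) 3) :
    ∃ ε > 0, ∀ k, ε ≤ inflow c (capMap θ) θ k [] := by
  obtain ⟨_, ⟨μ, hμ, hpot, rfl⟩, hpos⟩ := lt_sSup_iff.1 h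
  have hR : ∀ n : ℕ, (ENNReal.ofReal θ ^ n)⁻¹ = ENNReal.ofReal (θ ^ n)⁻¹ := fun n => by
    rw [← ENNReal.ofReal_pow hθ.le, ENNReal.ofReal_inv_of_pos (by positivity)]
  have hterm : ∀ y, IsRay c y → ∀ n : ℕ, (μ ((List.range (n + 1)).map y) *
      ENNReal.ofReal (θ ^ (n + 1))⁻¹) ^ 2 ≤ 1 := by
    intro y hy n
    have h1 := (ENNReal.le_tsum n).trans (hpot y hy)
    have h2 : (3 - 1 : ℝ) = ((2 : ℕ) : ℝ) := by norm_num
    simpa only [h2, ENNReal.rpow_natCast, List.length_map, List.length_range, hR] using h1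
  have hpot' : ∀ y, IsRay c y → ∀ N : ℕ, ∑ n ∈ Finset.range N, (μ ((List.range (n + 1)).map y) *
      ENNReal.ofReal (θ ^ (n + 1))⁻¹) ^ 2 ≤ 1 := by
    intro y hy N
    have h1 := (ENNReal.sum_le_tsum (Finset.range N)).trans (hpot y hy)
    have h2 : (3 - 1 : ℝ) = ((2 : ℕ) : ℝ) := by norm_num
    simpa only [h2, ENNReal.rpow_natCast, List.length_map, List.length_range, hR] using h1
  have hfin : ∀ v, IsVtx c v → v ≠ [] → μ v ≠ ∞ := by
    intro v hv hv0 htop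
    obtain ⟨y, hy, hyv⟩ := hv.exists_isRay hc
    obtain ⟨n, hn⟩ := Nat.exists_eq_succ_of_ne_zero (mt List.length_eq_zero_iff.1 hv0)
    have := hterm y hy n
    rw [hn] at hyv
    rw [hyv, htop, ENNReal.top_mul (by simpa using by positivity)] at this
    simp at this
  have hflow : ∀ v, IsVtx c v → v ≠ [] →
      (μ v).toReal = ∑ i ∈ Finset.range (c v), (μ (v ++ [i])).toReal := by
    intro v hv hv0
    rw [hμ v hv hv0 (Nat.one_le_iff_ne_zero.1 (hc v hv)), ENNReal.toReal_sum]
    exact fun i hi => hfin _ (hv.child (Finset.mem_range.1 hi)) (by simp)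
  have hsumreal : ∀ y, IsRay c y → ∀ N : ℕ, ∑ n ∈ Finset.range N,
      ((μ ((List.range (n + 1)).map y)).toReal * (θ ^ (n + 1))⁻¹) ^ 2 ≤ 1 := by
    intro y hy N
    have h1 := ENNReal.toReal_mono ENNReal.one_ne_top (hpot' y hy N)
    rw [ENNReal.toReal_sum, ENNReal.toReal_one] at h1
    · convert h1 using 2 with n
      rw [ENNReal.toReal_pow, ENNReal.toReal_mul, ENNReal.toReal_ofReal (by positivity)]
    · exact fun n _ => ((hterm y hy n).trans_lt ENNReal.one_lt_top).ne
  refine ⟨(flowMass c μ).toReal, ENNReal.toReal_pos hpos.ne' ?_, fun k => ?_⟩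
  · exact ENNReal.sum_ne_top.2 fun i hi => hfin [i] (IsVtx.root.child (Finset.mem_range.1 hi))
      (by simp)
  · rw [flowMass, ENNReal.toReal_sum fun i hi =>
      hfin [i] (IsVtx.root.child (Finset.mem_range.1 hi)) (by simp), inflow]
    refine Finset.sum_le_sum fun i hi => ?_
    have := flow_le_msg hc hθ (fun v => ENNReal.toReal_nonneg) hflow k
      (IsVtx.root.child (Finset.mem_range.1 hi)) (by simp) zero_le_one (fun y hy _ => ?_)
    · simp only [List.nil_append, List.length_singleton, pow_one, one_mul] at this ⊢
      rwa [← div_eq_mul_inv, div_le_div_iff_of_pos_right hθ] at this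
    · simpa [add_comm] using hsumreal y hy (k + 1)

/-- The infinite-volume normalised capacity at a vertex. -/
def limFlow (c : Vtx → ℕ) (θ : ℝ) (v : Vtx) : ℝ := ⨅ k, inflow c (capMap θ) θ k v

lemma inflow_capMap_nonneg (hθ : 0 < θ) (k : ℕ) (v : Vtx) : 0 ≤ inflow c (capMap θ) θ k v :=
  inflow_nonneg hθ.le (fun _ => capMap_nonneg hθ.le) k v

lemma tendsto_inflow_limFlow (hθ : 0 < θ) (v : Vtx) :
    Filter.Tendsto (fun k => inflow c (capMap θ) θ k v) Filter.atTop (nhds (limFlow c θ v)) :=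
  tendsto_atTop_ciInf (inflow_antitone (capMap_monotone hθ.le) (capMap_le hθ.le) v)
    ⟨0, by rintro _ ⟨k, rfl⟩; exact inflow_capMap_nonneg hθ k v⟩

lemma limFlow_nonneg (hθ : 0 < θ) (v : Vtx) : 0 ≤ limFlow c θ v :=
  le_ciInf fun k => inflow_capMap_nonneg hθ k v

lemma limFlow_eq (hθ : 0 < θ) (v : Vtx) :
    limFlow c θ v = ∑ i ∈ Finset.range (c v), capMap θ (limFlow c θ (v ++ [i])) := by
  refine tendsto_nhds_unique ((tendsto_inflow_limFlow hθ v).comp (Filter.tendsto_add_atTop_nat 1)) ?_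
  exact tendsto_finsetSum _ fun i _ =>
    ((capMap_continuous θ).tendsto _).comp (tendsto_inflow_limFlow hθ (v ++ [i]))

/-- The square root of the potential still available below a vertex. -/
def budget (c : Vtx → ℕ) (θ : ℝ) (v : Vtx) : ℝ :=
  ∏ j ∈ Finset.range v.length, (√(1 + limFlow c θ (v.take (j + 1)) ^ 2))⁻¹

lemma budget_append (v : Vtx) (i : ℕ) :
    budget c θ (v ++ [i]) = budget c θ v * (√(1 + limFlow c θ (v ++ [i]) ^ 2))⁻¹ := by
  rw [budget, List.length_append, List.length_singleton, Finset.prod_range_succ]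
  congr 1
  · refine Finset.prod_congr rfl fun j hj => ?_
    rw [List.take_append_of_le_length (by simpa using hj)]
  · rw [List.take_of_length_le (by simp)]

lemma budget_nonneg (v : Vtx) : 0 ≤ budget c θ v :=
  Finset.prod_nonneg fun _ _ => by positivity

lemma budget_sq_sub (v : Vtx) (i : ℕ) : (limFlow c θ (v ++ [i]) * budget c θ (v ++ [i])) ^ 2 =
    budget c θ v ^ 2 - budget c θ (v ++ [i]) ^ 2 := by
  rw [budget_append]
  have h : 0 < 1 + limFlow c θ (v ++ [i]) ^ 2 := by positivity
  simp only [mul_pow, inv_pow, Real.sq_sqrt h.le]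
  field_simp
  ring

lemma capInf_pos_of_le_inflow (hθ : 0 < θ)
    (h : ∃ ε > 0, ∀ k, ε ≤ inflow c (capMap θ) θ k []) :
    0 < capInf c (fun v => (ENNReal.ofReal θ ^ v.length)⁻¹) 3 := by
  obtain ⟨ε, hε, hk⟩ := h
  have hX : 0 < limFlow c θ [] := hε.trans_le (le_ciInf hk)
  set m : Vtx → ℝ := fun v => θ ^ v.length * limFlow c θ v * budget c θ v with hm
  have hm0 : ∀ v, 0 ≤ m v := fun v =>
    mul_nonneg (mul_nonneg (by positivity) (limFlow_nonneg hθ v)) (budget_nonneg v)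
  have hflow : ∀ v, m v = ∑ i ∈ Finset.range (c v), m (v ++ [i]) := by
    intro v
    simp only [hm]
    rw [limFlow_eq hθ, Finset.mul_sum, Finset.sum_mul]
    refine Finset.sum_congr rfl fun i _ => ?_
    rw [budget_append, capMap, List.length_append, List.length_singleton, pow_succ]
    ring
  have hsum : ∀ v, ENNReal.ofReal (m v) =
      ∑ i ∈ Finset.range (c v), ENNReal.ofReal (m (v ++ [i])) := fun v => by
    rw [hflow v, ENNReal.ofReal_sum_of_nonneg fun i _ => hm0 _]
  refine lt_of_lt_of_le ?_ (le_sSup ⟨fun v => ENNReal.ofReal (m v), fun v _ _ _ => hsum v,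
    fun y _ => ?_, rfl⟩)
  · have := hsum []
    simp only [List.nil_append] at this
    rw [flowMass, ← this, ENNReal.ofReal_pos]
    simpa [hm, budget] using hX
  · refine ENNReal.tsum_le_of_sum_range_le fun N => ?_
    have hterm : ∀ n, (ENNReal.ofReal (m ((List.range (n + 1)).map y)) *
        (ENNReal.ofReal θ ^ ((List.range (n + 1)).map y).length)⁻¹) ^ (3 - 1 : ℝ) =
        ENNReal.ofReal (budget c θ ((List.range n).map y) ^ 2 -
          budget c θ ((List.range (n + 1)).map y) ^ 2) := by
      intro n
      have h2 : (3 - 1 : ℝ) = ((2 : ℕ) : ℝ) := by norm_num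
      rw [h2, ENNReal.rpow_natCast, ← ENNReal.ofReal_pow hθ.le,
        ← ENNReal.ofReal_inv_of_pos (by positivity), ← ENNReal.ofReal_mul (hm0 _),
        ← ENNReal.ofReal_pow (mul_nonneg (hm0 _) (by positivity)), map_range_succ,
        ← budget_sq_sub]
      congr 2
      simp only [hm]
      field_simp
    rw [Finset.sum_congr rfl fun n _ => hterm n, ← ENNReal.ofReal_sum_of_nonneg,
      Finset.sum_range_sub', ← ENNReal.ofReal_one]
    · refine ENNReal.ofReal_le_ofReal ?_
      have : budget c θ ((List.range 0).map y) = 1 := by simp [budget]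
      rw [this]
      linarith [sq_nonneg (budget c θ ((List.range N).map y))]
    · intro n _
      rw [map_range_succ, ← budget_sq_sub]
      positivity

lemma lev_card_succ
    (hsym : ∀ v w : Vtx, IsVtx c v → IsVtx c w → v.length = w.length → c v = c w)
    {v : Vtx} (hv : IsVtx c v) :
    (lev c (v.length + 1)).card = (lev c v.length).card * c v := by
  rw [lev, Finset.card_biUnion]
  · rw [← smul_eq_mul, ← Finset.sum_const]
    refine Finset.sum_congr rfl fun w hw => ?_
    obtain ⟨hw, hl⟩ := mem_lev.1 hw
    rw [Finset.card_image_of_injective _ fun i j h => by simpa using h, Finset.card_range,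
      hsym w v hw hv hl]
  · intro v _ w _ hvw
    refine Finset.disjoint_left.2 fun x hx hx' => hvw ?_
    obtain ⟨i, _, rfl⟩ := Finset.mem_image.1 hx
    obtain ⟨j, _, h⟩ := Finset.mem_image.1 hx'
    exact (List.append_inj_left' h rfl).symm

lemma lev_card_pos {v : Vtx} (hv : IsVtx c v) : 0 < (lev c v.length).card :=
  Finset.card_pos.2 ⟨v, mem_lev.2 ⟨hv, rfl⟩⟩

/-- The general term of the series deciding positivity of the capacity of a spherically symmetric
tree. -/
def seriesTerm (c : Vtx → ℕ) (θ : ℝ) (n : ℕ) : ℝ :=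
  ((θ ^ (n + 1))⁻¹) ^ 2 * ((((lev c (n + 1)).card : ℝ)) ^ 2)⁻¹

lemma seriesTerm_nonneg (n : ℕ) : 0 ≤ seriesTerm c θ n := by
  unfold seriesTerm; positivity

lemma capMap_inv {a S : ℝ} (ha : 0 < a) (hS : 0 < S) :
    capMap θ (a * √S)⁻¹ = θ * (a * √(S + (a ^ 2)⁻¹))⁻¹ := by
  have h : √(S + (a ^ 2)⁻¹) = √S * √(1 + ((a * √S)⁻¹) ^ 2) := by
    rw [← Real.sqrt_mul hS.le, inv_pow, mul_pow, Real.sq_sqrt hS.le]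
    congr 1
    field_simp
  rw [h, capMap, div_eq_mul_inv, mul_assoc, ← mul_inv, mul_assoc a]

lemma msg_of_symmetric (hc : ∀ v, IsVtx c v → 1 ≤ c v) (hθ : 0 < θ)
    (hsym : ∀ v w : Vtx, IsVtx c v → IsVtx c w → v.length = w.length → c v = c w)
    (k n : ℕ) {v : Vtx} (hv : IsVtx c v) (hn : v.length = n + 1) :
    msg c (capMap θ) θ k v = (θ ^ n * (lev c (n + 1)).card *
      √(∑ j ∈ Finset.range (k + 1), seriesTerm c θ (n + j)))⁻¹ := by
  have hT : (0 : ℝ) < (lev c (n + 1)).card := by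
    rw [← hn]; exact_mod_cast lev_card_pos hv
  induction k generalizing n v with
  | zero =>
    rw [zero_add, Finset.sum_range_one, add_zero, seriesTerm, ← inv_pow _ 2, ← mul_pow,
      Real.sqrt_sq (by positivity), msg]
    field_simp
    ring
  | succ k ih =>
    have hcv : (0 : ℝ) < c v := by exact_mod_cast hc v hv
    have hcard : ((lev c (n + 1 + 1)).card : ℝ) = (lev c (n + 1)).card * c v := by
      have := lev_card_succ hsym hv
      rw [hn] at this
      exact_mod_cast this
    have hin : inflow c (capMap θ) θ k v = (θ ^ (n + 1) * (lev c (n + 1)).card *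
        √(∑ j ∈ Finset.range (k + 1), seriesTerm c θ (n + 1 + j)))⁻¹ := by
      rw [inflow, Finset.sum_congr rfl fun i hi => ih (n + 1)
        (hv.child (Finset.mem_range.1 hi)) (by simp [hn]) (by rw [hcard]; positivity),
        Finset.sum_const, Finset.card_range, nsmul_eq_mul, hcard]
      field_simp
    have hS : 0 < ∑ j ∈ Finset.range (k + 1), seriesTerm c θ (n + 1 + j) := by
      rw [Finset.sum_range_succ']
      refine add_pos_of_nonneg_of_pos (Finset.sum_nonneg fun _ _ => seriesTerm_nonneg _) ?_
      rw [seriesTerm, add_zero, hcard]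
      positivity
    rw [msg_succ, hin, capMap_inv (by positivity) hS, Finset.sum_range_succ' _ (k + 1)]
    have e : ((θ ^ (n + 1) * ((lev c (n + 1)).card : ℝ)) ^ 2)⁻¹ = seriesTerm c θ (n + 0) := by
      rw [seriesTerm, add_zero, mul_pow, mul_inv, inv_pow]
    simp only [e, add_assoc, add_comm 1]
    rw [pow_succ]
    field_simp

lemma exists_le_inflow_iff_summable (hc : ∀ v, IsVtx c v → 1 ≤ c v) (hθ : 0 < θ)
    (hsym : ∀ v w : Vtx, IsVtx c v → IsVtx c w → v.length = w.length → c v = c w) :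
    (∃ ε > 0, ∀ k, ε ≤ inflow c (capMap θ) θ k []) ↔ Summable (seriesTerm c θ) := by
  have hc0 : (0 : ℝ) < c [] := by exact_mod_cast hc [] IsVtx.root
  have hcard : ((lev c 1).card : ℝ) = c [] := by
    have := lev_card_succ hsym (IsVtx.root (c := c))
    simpa [lev] using this
  have hin : ∀ k, inflow c (capMap θ) θ k [] =
      (√(∑ j ∈ Finset.range (k + 1), seriesTerm c θ j))⁻¹ := by
    intro k
    rw [inflow, Finset.sum_congr rfl fun i hi => msg_of_symmetric hc hθ hsym k 0
      (IsVtx.root.child (Finset.mem_range.1 hi)) (by simp), Finset.sum_const, Finset.card_range,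
      nsmul_eq_mul, zero_add, hcard]
    simp only [zero_add]
    field_simp
  have hS : ∀ k, 0 < ∑ j ∈ Finset.range (k + 1), seriesTerm c θ j := by
    intro k
    rw [Finset.sum_range_succ']
    refine add_pos_of_nonneg_of_pos (Finset.sum_nonneg fun _ _ => seriesTerm_nonneg _) ?_
    rw [seriesTerm, zero_add, hcard]
    positivity
  constructor
  · rintro ⟨ε, hε, h⟩
    refine summable_of_sum_range_le (c := (ε ^ 2)⁻¹) seriesTerm_nonneg fun n => ?_
    refine (Finset.sum_le_sum_of_subset_of_nonneg (Finset.range_mono n.le_succ)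
      fun _ _ _ => seriesTerm_nonneg _).trans ?_
    have h1 := h n
    rw [hin, le_inv_comm₀ hε (Real.sqrt_pos.2 (hS n)), Real.sqrt_le_left (by positivity)] at h1
    rwa [← inv_pow]
  · intro h
    have hle : ∀ k, ∑ j ∈ Finset.range (k + 1), seriesTerm c θ j ≤ ∑' j, seriesTerm c θ j :=
      fun k => h.sum_le_tsum _ fun _ _ => seriesTerm_nonneg _
    have hpos := (hS 0).trans_le (hle 0)
    refine ⟨(√(∑' j, seriesTerm c θ j))⁻¹, inv_pos.2 (Real.sqrt_pos.2 hpos), fun k => ?_⟩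
    rw [hin]
    exact inv_anti₀ (Real.sqrt_pos.2 (hS k)) (Real.sqrt_le_sqrt (hle k))

end Capacity

section PartitionFunction

/-- The real value of a Boolean spin. -/
def spinSign (t : Bool) : ℝ := if t then 1 else -1

/-- Extend a configuration on a finite set by plus spins. -/
def extendConf (s : Finset Vtx) (σ : {v // v ∈ s} → Bool) (v : Vtx) : Bool :=
  if h : v ∈ s then σ ⟨v, h⟩ else true

/-- The sum of `G` over all configurations on `s`, extended by plus spins. -/
def confSum (s : Finset Vtx) (G : (Vtx → Bool) → ℝ) : ℝ :=
  ∑ σ : {v // v ∈ s} → Bool, G (extendConf s σ)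

lemma confSum_union {s t : Finset Vtx} (hst : Disjoint s t) (G : (Vtx → Bool) → ℝ) :
    confSum (s ∪ t) G =
      confSum s fun η => confSum t fun ξ => G fun v => if v ∈ t then ξ v else η v := by
  simp only [confSum]
  rw [← Fintype.sum_prod_type']
  refine (Fintype.sum_equiv (Equiv.piFinsetUnion (fun _ => Bool) hst) _ _ ?_).symm
  rintro ⟨f, g⟩
  congr 1
  funext v
  by_cases ht : v ∈ t
  · simp only [extendConf, ht, if_true, dif_pos, Finset.mem_union, or_true]
    rw [Equiv.piFinsetUnion_right _ hst ht]
  · by_cases hs : v ∈ s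
    · simp only [extendConf, ht, if_false, dif_pos, Finset.mem_union, hs, true_or]
      rw [Equiv.piFinsetUnion_left _ hst hs]
    · simp [extendConf, ht, hs]

lemma confSum_prod (t : Finset Vtx) (g : Vtx → Bool → ℝ) :
    confSum t (fun ξ => ∏ v ∈ t, g v (ξ v)) = ∏ v ∈ t, ∑ a, g v a := by
  rw [← Finset.prod_coe_sort t, Fintype.prod_sum, confSum]
  refine Finset.sum_congr rfl fun σ _ => ?_
  rw [← Finset.prod_coe_sort t]
  exact Finset.prod_congr rfl fun v _ => by simp [extendConf]

lemma confSum_mul_left (s : Finset Vtx) (a : ℝ) (G : (Vtx → Bool) → ℝ) :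
    confSum s (fun η => a * G η) = a * confSum s G := (Finset.mul_sum _ _ _).symm

/-- The Gibbs weight of a configuration on the tree cut at depth `N`. -/
def edgeWt (c : Vtx → ℕ) (b : ℝ) (N : ℕ) (η : Vtx → Bool) : ℝ :=
  ∏ w ∈ (Finset.range N).biUnion (fun n => lev c (n + 1)),
    Real.exp (b * spinSign (η w.dropLast) * spinSign (η w))

/-- The partition function at depth `N` with an external factor `H` on level `N` and `r` at the
root. -/
def partitionFn (c : Vtx → ℕ) (b : ℝ) (r : Bool → ℝ) (N : ℕ) (H : Vtx → Bool → ℝ) : ℝ :=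
  confSum (verts c N) fun η => r (η []) * edgeWt c b N η * ∏ v ∈ lev c N, H v (η v)

/-- The factor felt by a vertex of spin `s` after summing out the spin of its child `w`. -/
def childFactor (b : ℝ) (H : Vtx → Bool → ℝ) (w : Vtx) (s : Bool) : ℝ :=
  ∑ t, Real.exp (b * spinSign s * spinSign t) * H w t

/-- The external factor obtained by summing out the children. -/
def sumChildren (c : Vtx → ℕ) (b : ℝ) (H : Vtx → Bool → ℝ) (v : Vtx) (s : Bool) : ℝ :=
  ∏ i ∈ Finset.range (c v), childFactor b H (v ++ [i]) s

variable {c : Vtx → ℕ}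

lemma verts_succ (N : ℕ) : verts c (N + 1) = verts c N ∪ lev c (N + 1) := by
  rw [verts, Finset.range_add_one, Finset.biUnion_insert, Finset.union_comm, verts]

lemma length_of_mem_lev {n : ℕ} {v : Vtx} (h : v ∈ lev c n) : v.length = n := (mem_lev.1 h).2

lemma mem_verts {N : ℕ} {v : Vtx} : v ∈ verts c N ↔ IsVtx c v ∧ v.length ≤ N := by
  simp [verts, mem_lev, and_comm]

lemma disjoint_verts_lev (N : ℕ) : Disjoint (verts c N) (lev c (N + 1)) := by
  refine Finset.disjoint_left.2 fun v h1 h2 => ?_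
  have := (mem_verts.1 h1).2
  have := length_of_mem_lev h2
  omega

lemma prod_lev_succ (N : ℕ) (F : Vtx → ℝ) :
    ∏ w ∈ lev c (N + 1), F w = ∏ v ∈ lev c N, ∏ i ∈ Finset.range (c v), F (v ++ [i]) := by
  rw [lev, Finset.prod_biUnion]
  · exact Finset.prod_congr rfl fun v _ => Finset.prod_image fun i _ j _ h => by simpa using h
  · intro v _ w _ hvw
    refine Finset.disjoint_left.2 fun x hx hx' => hvw ?_
    obtain ⟨i, _, rfl⟩ := Finset.mem_image.1 hx
    obtain ⟨j, _, h⟩ := Finset.mem_image.1 hx'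
    exact (List.append_inj_left' h rfl).symm

lemma edgeWt_succ (b : ℝ) (N : ℕ) (η : Vtx → Bool) :
    edgeWt c b (N + 1) η = edgeWt c b N η *
      ∏ w ∈ lev c (N + 1), Real.exp (b * spinSign (η w.dropLast) * spinSign (η w)) := by
  rw [edgeWt, Finset.range_add_one, Finset.biUnion_insert, Finset.prod_union, mul_comm, edgeWt]
  refine Finset.disjoint_left.2 fun v h1 h2 => ?_
  obtain ⟨n, hn, h⟩ := Finset.mem_biUnion.1 h2
  have := length_of_mem_lev h
  have := length_of_mem_lev h1
  have := Finset.mem_range.1 hn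
  omega

lemma edgeWt_congr (b : ℝ) (N : ℕ) {η ξ : Vtx → Bool}
    (h : ∀ v, v.length ≤ N → η v = ξ v) : edgeWt c b N η = edgeWt c b N ξ := by
  refine Finset.prod_congr rfl fun w hw => ?_
  obtain ⟨n, hn, hw⟩ := Finset.mem_biUnion.1 hw
  have h1 := length_of_mem_lev hw
  have h2 := Finset.mem_range.1 hn
  rw [h w (by omega), h w.dropLast (by simp; omega)]

lemma partitionFn_succ (b : ℝ) (r : Bool → ℝ) (N : ℕ) (H : Vtx → Bool → ℝ) :
    partitionFn c b r (N + 1) H = partitionFn c b r N (sumChildren c b H) := by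
  rw [partitionFn, verts_succ, confSum_union (disjoint_verts_lev N), partitionFn]
  congr 1
  funext η
  have hlow : ∀ (ξ : Vtx → Bool) (v : Vtx), v.length ≤ N →
      (if v ∈ lev c (N + 1) then ξ v else η v) = η v := by
    intro ξ v hv
    rw [if_neg]
    intro h
    have := length_of_mem_lev h
    omega
  have hG : ∀ ξ : Vtx → Bool,
      r (if ([] : Vtx) ∈ lev c (N + 1) then ξ [] else η []) *
        edgeWt c b (N + 1) (fun v => if v ∈ lev c (N + 1) then ξ v else η v) *
        ∏ v ∈ lev c (N + 1), H v (if v ∈ lev c (N + 1) then ξ v else η v) =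
      (r (η []) * edgeWt c b N η) * ∏ w ∈ lev c (N + 1),
        (Real.exp (b * spinSign (η w.dropLast) * spinSign (ξ w)) * H w (ξ w)) := by
    intro ξ
    rw [hlow ξ [] (Nat.zero_le _), edgeWt_succ, edgeWt_congr b N (hlow ξ),
      Finset.prod_mul_distrib, mul_assoc, mul_assoc, mul_assoc]
    congr 3
    · refine Finset.prod_congr rfl fun w hw => ?_
      rw [hlow ξ w.dropLast (by simp [length_of_mem_lev hw]), if_pos hw]
    · exact Finset.prod_congr rfl fun w hw => by rw [if_pos hw]
  simp only [hG]
  rw [confSum_mul_left, confSum_prod (lev c (N + 1)) fun w t =>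
    Real.exp (b * spinSign (η w.dropLast) * spinSign t) * H w t, prod_lev_succ]
  simp only [List.dropLast_concat, sumChildren, childFactor]

/-- The plus boundary condition as an external factor. -/
def plusFactor (_ : Vtx) (t : Bool) : ℝ := if t then 1 else 0

/-- The partition function of the tree of depth `k` below `v`, with plus boundary conditions and
spin `s` at `v`. -/
def subtreeFn (c : Vtx → ℕ) (b : ℝ) (k : ℕ) : Vtx → Bool → ℝ :=
  (sumChildren c b)^[k] plusFactor

lemma subtreeFn_succ (b : ℝ) (k : ℕ) (v : Vtx) (s : Bool) :
    subtreeFn c b (k + 1) v s =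
      ∏ i ∈ Finset.range (c v), childFactor b (subtreeFn c b k) (v ++ [i]) s := by
  rw [subtreeFn, Function.iterate_succ_apply']
  rfl

lemma partitionFn_zero (b : ℝ) (r : Bool → ℝ) (H : Vtx → Bool → ℝ) :
    partitionFn c b r 0 H = ∑ s, r s * H [] s := by
  have h : verts c 0 = {[]} := by simp [verts, lev]
  rw [partitionFn, h]
  have := confSum_prod {[]} fun _ s => r s * H [] s
  simpa [edgeWt, lev] using this

lemma partitionFn_plusFactor (b : ℝ) (r : Bool → ℝ) (N : ℕ) :
    partitionFn c b r N plusFactor = ∑ s, r s * subtreeFn c b N [] s := by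
  have key : ∀ N k, partitionFn c b r N (subtreeFn c b k) =
      ∑ s, r s * subtreeFn c b (k + N) [] s := by
    intro N
    induction N with
    | zero => exact fun k => partitionFn_zero b r _
    | succ N ih =>
      intro k
      have : sumChildren c b (subtreeFn c b k) = subtreeFn c b (k + 1) := by
        rw [subtreeFn, subtreeFn, Function.iterate_succ_apply']
      rw [partitionFn_succ, this, ih, add_assoc, add_comm 1]
  simpa [subtreeFn] using key N 0

lemma childFactor_subtreeFn (b : ℝ) (k : ℕ) (w : Vtx) :
    0 < childFactor b (subtreeFn c b k) w false ∧
    childFactor b (subtreeFn c b k) w true =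
      childFactor b (subtreeFn c b k) w false *
        Real.exp (msg c (isingMap b) (2 * b) k w) := by
  induction k generalizing w with
  | zero =>
    simp only [childFactor, subtreeFn, Function.iterate_zero, id, plusFactor, spinSign,
      Fintype.sum_bool, msg]
    simp only [if_true, Bool.false_eq_true, if_false, mul_zero, mul_one, add_zero,
      ← Real.exp_add]
    exact ⟨Real.exp_pos _, by ring_nf⟩
  | succ k ih =>
    have hpos : 0 < subtreeFn c b (k + 1) w false := by
      rw [subtreeFn_succ]; exact Finset.prod_pos fun i _ => (ih _).1
    have hrat : subtreeFn c b (k + 1) w true = subtreeFn c b (k + 1) w false *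
        Real.exp (inflow c (isingMap b) (2 * b) k w) := by
      rw [subtreeFn_succ, subtreeFn_succ, inflow, Real.exp_sum, ← Finset.prod_mul_distrib]
      exact Finset.prod_congr rfl fun i _ => (ih _).2
    rw [msg_succ, isingMap, Real.exp_log (by positivity)]
    simp only [childFactor, spinSign, Fintype.sum_bool, if_true, Bool.false_eq_true, if_false,
      mul_one, mul_neg, neg_neg, hrat]
    refine ⟨by positivity, ?_⟩
    field_simp

lemma subtreeFn_ratio (b : ℝ) (k : ℕ) (v : Vtx) :
    0 < subtreeFn c b (k + 1) v false ∧
    subtreeFn c b (k + 1) v true = subtreeFn c b (k + 1) v false *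
      Real.exp (inflow c (isingMap b) (2 * b) k v) := by
  constructor
  · rw [subtreeFn_succ]; exact Finset.prod_pos fun i _ => (childFactor_subtreeFn b k _).1
  · rw [subtreeFn_succ, subtreeFn_succ, inflow, Real.exp_sum, ← Finset.prod_mul_distrib]
    exact Finset.prod_congr rfl fun i _ => (childFactor_subtreeFn b k _).2

lemma spin_eq (N : ℕ) (σ : Conf c N) (w : Vtx) :
    spin c N σ w = spinSign (extendConf (verts c N) σ w) := by
  unfold spin extendConf spinSign
  split_ifs <;> simp_all

lemma wt_eq (J β : ℝ) (N : ℕ) (σ : Conf c N) :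
    wt c (fun _ => J) β N σ = edgeWt c (β * J) N (extendConf (verts c N) σ) := by
  simp only [wt, edgeWt, spin_eq]

lemma prod_plusFactor (N : ℕ) (σ : Conf c N) :
    ∏ v ∈ lev c N, plusFactor v (extendConf (verts c N) σ v) =
      if (∀ x : {v // v ∈ verts c N}, x.1 ∈ lev c N → σ x = true) then 1 else 0 := by
  have hsub : ∀ v ∈ lev c N, v ∈ verts c N := fun v hv =>
    mem_verts.2 ⟨(mem_lev.1 hv).1, (length_of_mem_lev hv).le⟩
  split_ifs with h
  · refine Finset.prod_eq_one fun v hv => ?_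
    have : extendConf (verts c N) σ v = σ ⟨v, hsub v hv⟩ := dif_pos (hsub v hv)
    rw [this, h _ hv, plusFactor, if_pos rfl]
  · push Not at h
    obtain ⟨⟨v, hv⟩, hl, hσ⟩ := h
    refine Finset.prod_eq_zero hl ?_
    have : extendConf (verts c N) σ v = σ ⟨v, hv⟩ := dif_pos hv
    rw [this, plusFactor, if_neg hσ]

lemma spinSign_eq_one_iff (t : Bool) : spinSign t = 1 ↔ t = true := by
  cases t <;> norm_num [spinSign]

lemma sum_conf (N : ℕ) (G : (Vtx → Bool) → ℝ) :
    ∑ σ : Conf c N, G (extendConf (verts c N) σ) = confSum (verts c N) G :=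
  Fintype.sum_equiv (Equiv.refl _) _ _ fun _ => rfl

lemma plus_boundary_ite (J β : ℝ) (N : ℕ) (σ : Conf c N) :
    (if (∀ x : {v // v ∈ verts c N}, x.1 ∈ lev c N → σ x = true)
      then wt c (fun _ => J) β N σ else 0) =
    (fun η : Vtx → Bool => 1 * edgeWt c (β * J) N η * ∏ v ∈ lev c N, plusFactor v (η v))
      (extendConf (verts c N) σ) := by
  simp only [prod_plusFactor, wt_eq]
  rw [one_mul, mul_ite, mul_one, mul_zero]

lemma plus_boundary_root_ite (J β : ℝ) (N : ℕ) (σ : Conf c N) :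
    (if (∀ x : {v // v ∈ verts c N}, x.1 ∈ lev c N → σ x = true) ∧ spin c N σ [] = 1
      then wt c (fun _ => J) β N σ else 0) =
    (fun η : Vtx → Bool => (if η [] then 1 else 0) * edgeWt c (β * J) N η *
      ∏ v ∈ lev c N, plusFactor v (η v)) (extendConf (verts c N) σ) := by
  simp only [prod_plusFactor, wt_eq, spin_eq, spinSign_eq_one_iff]
  rw [ite_and, mul_ite, mul_one, mul_zero, ite_mul, one_mul, zero_mul]

lemma plusProb_eq (J β : ℝ) (N : ℕ) :
    plusProb c (fun _ => J) β N = subtreeFn c (β * J) N [] true /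
      (subtreeFn c (β * J) N [] true + subtreeFn c (β * J) N [] false) := by
  have h1 := partitionFn_plusFactor (c := c) (β * J) (fun _ => 1) N
  have h2 := partitionFn_plusFactor (c := c) (β * J) (fun t => if t then 1 else 0) N
  simp only [Fintype.sum_bool, one_mul, if_true, Bool.false_eq_true, if_false, zero_mul,
    add_zero] at h1 h2
  rw [← h1, ← h2, partitionFn, partitionFn, ← sum_conf, ← sum_conf, plusProb]
  exact congrArg₂ _ (Finset.sum_congr rfl fun σ _ => plus_boundary_root_ite J β N σ)
    (Finset.sum_congr rfl fun σ _ => plus_boundary_ite J β N σ)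

lemma plusProb_succ (J β : ℝ) (N : ℕ) :
    plusProb c (fun _ => J) β (N + 1) =
      (1 + Real.exp (-inflow c (isingMap (β * J)) (2 * (β * J)) N []))⁻¹ := by
  obtain ⟨hpos, hrat⟩ := subtreeFn_ratio (c := c) (β * J) N []
  rw [plusProb_eq, hrat, Real.exp_neg]
  have := Real.exp_pos (inflow c (isingMap (β * J)) (2 * (β * J)) N [])
  field_simp

lemma plusProb_limit_gt_iff (J β : ℝ) (hb : 0 < β * J) :
    (∃ L : ℝ, Filter.Tendsto (fun N : ℕ => plusProb c (fun _ => J) β N) Filter.atTop (nhds L) ∧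
      1 / 2 < L) ↔ ∃ ε > 0, ∀ k, ε ≤ inflow c (isingMap (β * J)) (2 * (β * J)) k [] := by
  set h : ℕ → ℝ := fun k => inflow c (isingMap (β * J)) (2 * (β * J)) k [] with hh
  have hnn : ∀ k, 0 ≤ h k := fun k =>
    inflow_nonneg (by positivity) (fun _ => isingMap_nonneg hb) k []
  have hbdd : BddBelow (Set.range h) := ⟨0, by rintro _ ⟨k, rfl⟩; exact hnn k⟩
  have hlim : Filter.Tendsto h Filter.atTop (nhds (⨅ k, h k)) :=
    tendsto_atTop_ciInf (inflow_antitone (isingMap_monotone hb) (isingMap_le hb) []) hbdd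
  have hprob : Filter.Tendsto (fun N : ℕ => plusProb c (fun _ => J) β N) Filter.atTop
      (nhds (1 + Real.exp (-⨅ k, h k))⁻¹) := by
    rw [← Filter.tendsto_add_atTop_iff_nat 1]
    simp only [plusProb_succ]
    exact ((Real.continuous_exp.tendsto _ |>.comp hlim.neg).const_add 1).inv₀ (by positivity)
  have hgt : 1 / 2 < (1 + Real.exp (-⨅ k, h k))⁻¹ ↔ 0 < ⨅ k, h k := by
    rw [one_div, inv_lt_inv₀ (by norm_num) (by positivity), ← Left.neg_neg_iff, ← Real.exp_lt_one_iff]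
    constructor <;> intro <;> linarith
  constructor
  · rintro ⟨L, hL, hL2⟩
    rw [tendsto_nhds_unique hL hprob] at hL2
    exact ⟨_, hgt.1 hL2, fun k => ciInf_le hbdd k⟩
  · rintro ⟨ε, hε, hk⟩
    exact ⟨_, hprob, hgt.2 (hε.trans_le (le_ciInf hk))⟩

end PartitionFunction

theorem stmt5 (c : Vtx → ℕ) (hleafless : ∀ v, IsVtx c v → 1 ≤ c v)
    (J β : ℝ) (hJ : 0 < J) (hβ : 0 < β) :
    ((∃ L : ℝ, Filter.Tendsto (fun N : ℕ => plusProb c (fun _ => J) β N) Filter.atTop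
          (nhds L) ∧ 1 / 2 < L) ↔
        0 < capInf c (fun v => (ENNReal.ofReal (Real.tanh (β * J)) ^ v.length)⁻¹) 3) ∧
      ((∀ v w : Vtx, IsVtx c v → IsVtx c w → v.length = w.length → c v = c w) →
        ((∃ L : ℝ, Filter.Tendsto (fun N : ℕ => plusProb c (fun _ => J) β N) Filter.atTop
            (nhds L) ∧ 1 / 2 < L) ↔
          Summable (fun n : ℕ =>
            ((Real.tanh (β * J) ^ (n + 1))⁻¹) ^ 2 * ((((lev c (n + 1)).card : ℝ)) ^ 2)⁻¹))) := by
  have hb : 0 < β * J := mul_pos hβ hJ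
  have hθ := tanh_pos_of_pos hb
  have hiff := (plusProb_limit_gt_iff (c := c) J β hb).trans (exists_le_inflow_ising_iff c hb)
  exact ⟨hiff.trans ⟨capInf_pos_of_le_inflow hθ, exists_le_inflow_of_capInf_pos hleafless hθ⟩,
    fun hsym => hiff.trans (exists_le_inflow_iff_summable hleafless hθ hsym)⟩
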